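/- arXiv:2109.00655 — 2 statements merged into one kernel-verified Lean document; each statement's English description precedes it below -/
import Mathlib

section
/- Theorem 1 (octahedral case). For every octahedral disk packing y (indexed by {±1,±2,±3}) there exists an orthoplicial sphere packing x such that the set of curvatures of the octahedral Apollonian packing Ω(y) is contained in the set of curvatures of the orthoplicial Apollonian packing Ω(x), i.e. {κ(b) : b ∈ Ω(y)} ⊆ {κ'(b) : b ∈ Ω(x)}; moreover Ω(y) is integral if and only if Ω(x) is integral. -/
noncomputable section

/-- Inversive product on ℝ⁴. -/
def Q2 (a b : Fin 4 → ℝ) : ℝ := a 0 * b 0 + a 1 * b 1 + a 2 * b 2 - a 3 * b 3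

/-- Curvature of a disk in inversive coordinates. -/
def curv2 (a : Fin 4 → ℝ) : ℝ := a 3 - a 2

/-- Inversive product on ℝ⁵. -/
def Q3 (a b : Fin 5 → ℝ) : ℝ := a 0 * b 0 + a 1 * b 1 + a 2 * b 2 + a 3 * b 3 - a 4 * b 4

/-- Curvature of a sphere in inversive coordinates. -/
def curv3 (a : Fin 5 → ℝ) : ℝ := a 4 - a 3

/-- An octahedral disk packing, indexed by `{±1,±2,±3}` (here `Fin 3 × Bool`,
with negation flipping the boolean). -/
def IsOctaPacking (y : Fin 3 × Bool → (Fin 4 → ℝ)) : Prop :=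
  (∀ k, Q2 (y k) (y k) = 1) ∧
  (∀ k l, l ≠ k → l ≠ (k.1, !k.2) → Q2 (y k) (y l) = -1) ∧
  (∀ k, Q2 (y k) (y (k.1, !k.2)) = -3)

/-- Generators of the octahedral Apollonian group. -/
def octaGens (y : Fin 3 × Bool → (Fin 4 → ℝ)) : Set ((Fin 4 → ℝ) ≃ₗ[ℝ] (Fin 4 → ℝ)) :=
  {g | ∃ w : Fin 4 → ℝ, Q2 w w = 1 ∧ (∃ ε : Fin 3 → Bool, ∀ i, Q2 w (y (i, ε i)) = 0) ∧
        ∀ z, g z = z - (2 * Q2 z w) • w}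

/-- The octahedral Apollonian packing. -/
def octaOmega (y : Fin 3 × Bool → (Fin 4 → ℝ)) : Set (Fin 4 → ℝ) :=
  {b | ∃ g ∈ Subgroup.closure (octaGens y), ∃ k, b = g (y k)}

/-- An orthoplicial sphere packing, indexed by `{±1,±2,±3,±4}`. -/
def IsOrthoPacking (x : Fin 4 × Bool → (Fin 5 → ℝ)) : Prop :=
  (∀ k, Q3 (x k) (x k) = 1) ∧
  (∀ k l, l ≠ k → l ≠ (k.1, !k.2) → Q3 (x k) (x l) = -1) ∧
  (∀ k, Q3 (x k) (x (k.1, !k.2)) = -3)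

/-- Generators of the orthoplicial Apollonian group. -/
def orthoGens (x : Fin 4 × Bool → (Fin 5 → ℝ)) : Set ((Fin 5 → ℝ) ≃ₗ[ℝ] (Fin 5 → ℝ)) :=
  {g | ∃ w : Fin 5 → ℝ, Q3 w w = 1 ∧ (∃ ε : Fin 4 → Bool, ∀ i, Q3 w (x (i, ε i)) = 0) ∧
        ∀ z, g z = z - (2 * Q3 z w) • w}

/-- The orthoplicial Apollonian packing. -/
def orthoOmega (x : Fin 4 × Bool → (Fin 5 → ℝ)) : Set (Fin 5 → ℝ) :=
  {b | ∃ g ∈ Subgroup.closure (orthoGens x), ∃ k, b = g (x k)}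

/-- The sign `±1` attached to a vertex label. -/
def boolSign (b : Bool) : ℝ := if b then 1 else -1

lemma boolSign_mul_self (b : Bool) : boolSign b * boolSign b = 1 := by
  cases b <;> norm_num [boolSign]

/-- The centre `c` and half-diagonals `d` of an octahedral disk packing. -/
structure IsOctaFrame (c : Fin 4 → ℝ) (d : Fin 3 → Fin 4 → ℝ) : Prop where
  center : Q2 c c = -1
  center_diag : ∀ i, Q2 c (d i) = 0
  diag : ∀ i j, Q2 (d i) (d j) = if i = j then 2 else 0

/-- The centre `c` and half-diagonals `d` of an orthoplicial sphere packing. -/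
structure IsOrthoFrame (c : Fin 5 → ℝ) (d : Fin 4 → Fin 5 → ℝ) : Prop where
  center : Q3 c c = -1
  center_diag : ∀ i, Q3 c (d i) = 0
  diag : ∀ i j, Q3 (d i) (d j) = if i = j then 2 else 0
  expand : ∀ z, z = -Q3 z c • c + ∑ i, (Q3 z (d i) / 2) • d i

lemma IsOctaFrame.expand {c : Fin 4 → ℝ} {d : Fin 3 → Fin 4 → ℝ} (h : IsOctaFrame c d)
    (z : Fin 4 → ℝ) : z = -Q2 z c • c + ∑ i, (Q2 z (d i) / 2) • d i := by
  set M : Matrix (Fin 4) (Fin 4) ℝ := Matrix.of ![c, d 0, d 1, d 2] with hM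
  set N : Matrix (Fin 4) (Fin 4) ℝ := Matrix.of fun j a =>
    ![1, 1, 1, -1] j * M a j * ![-1, 1 / 2, 1 / 2, 1 / 2] a with hN
  have h1 : M * N = 1 := by
    have hc := h.center
    have hcd := h.center_diag
    have hd := h.diag
    simp only [Q2, Fin.forall_fin_succ, IsEmpty.forall_iff] at hc hcd hd
    simp at hc hcd hd
    obtain ⟨h01, h02, h03⟩ := hcd
    obtain ⟨⟨h11, h12, h13⟩, ⟨h21, h22, h23⟩, h31, h32, h33⟩ := hd
    ext a b
    rw [Matrix.mul_apply, Fin.sum_univ_four]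
    fin_cases a <;> fin_cases b <;> simp [hM, hN] <;> linarith
  have h2 : N * M = 1 := mul_eq_one_comm.mp h1
  ext k
  have h3 : Matrix.vecMul z (N * M) k = z k := by rw [h2, Matrix.vecMul_one]
  simp [hM, hN, Matrix.vecMul, dotProduct, Matrix.mul_apply, Fin.sum_univ_four] at h3
  simp [Fin.sum_univ_three, Q2]
  linear_combination -h3

lemma IsOctaFrame.curv2_sq {c : Fin 4 → ℝ} {d : Fin 3 → Fin 4 → ℝ} (h : IsOctaFrame c d) :
    2 * curv2 c ^ 2 = ∑ i, curv2 (d i) ^ 2 := by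
  have e := h.expand ![0, 0, 1, 1]
  have e2 := congrFun e 2
  have e3 := congrFun e 3
  simp [Q2, Fin.sum_univ_three] at e2 e3
  simp only [curv2, Fin.sum_univ_three]
  linear_combination 2 * e2 - 2 * e3

lemma IsOctaPacking.exists_frame {y : Fin 3 × Bool → Fin 4 → ℝ} (hy : IsOctaPacking y) :
    ∃ c d, IsOctaFrame c d ∧ ∀ i b, y (i, b) = c + boolSign b • d i := by
  obtain ⟨h1, h2, h3⟩ := hy
  have hne : ∀ {i j : Fin 3}, i ≠ j → ∀ a b, Q2 (y (i, a)) (y (j, b)) = -1 := fun hij a b =>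
    h2 _ _ (by simp [hij.symm]) (by simp [hij.symm])
  have hop : ∀ i, Q2 (y (i, true)) (y (i, false)) = -3 := fun i => h3 (i, true)
  have key : ∀ i j, Q2 (y (i, true)) (y (j, true)) = (if i = j then 1 else -1) ∧
      Q2 (y (i, true)) (y (j, false)) = (if i = j then -3 else -1) ∧
      Q2 (y (i, false)) (y (j, true)) = (if i = j then -3 else -1) ∧
      Q2 (y (i, false)) (y (j, false)) = (if i = j then 1 else -1) := by
    intro i j
    by_cases hij : i = j
    · subst hij
      simpa using ⟨h1 _, hop i, h3 (i, false), h1 _⟩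
    · simp [hij, hne hij]
  let c : Fin 4 → ℝ := (1 / 2 : ℝ) • (y (0, true) + y (0, false))
  let d : Fin 3 → Fin 4 → ℝ := fun i => (1 / 2 : ℝ) • (y (i, true) - y (i, false))
  have hs : ∀ i, Q2 (y (i, true) + y (i, false)) c = -2 := by
    intro i
    obtain ⟨k1, k2, k3, k4⟩ := key i 0
    simp only [Q2, c, Pi.add_apply, Pi.smul_apply, smul_eq_mul] at *
    split_ifs at * <;> linarith
  have hsd : ∀ i j, Q2 (y (i, true) + y (i, false)) (d j) = 0 := by
    intro i j
    obtain ⟨k1, k2, k3, k4⟩ := key i j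
    simp only [Q2, d, Pi.add_apply, Pi.sub_apply, Pi.smul_apply, smul_eq_mul] at *
    split_ifs at * <;> linarith
  have hf : IsOctaFrame c d := by
    refine ⟨?_, fun j => ?_, fun i j => ?_⟩
    · have := hs 0
      simp only [Q2, c, Pi.add_apply, Pi.smul_apply, smul_eq_mul] at *
      linarith
    · have := hsd 0 j
      simp only [Q2, c, Pi.add_apply, Pi.smul_apply, smul_eq_mul] at *
      linarith
    · obtain ⟨k1, k2, k3, k4⟩ := key i j
      simp only [Q2, d, Pi.sub_apply, Pi.smul_apply, smul_eq_mul] at *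
      split_ifs at * <;> linarith
  refine ⟨c, d, hf, fun i b => ?_⟩
  have e := hf.expand (y (i, true) + y (i, false))
  simp only [hs, hsd, zero_div, zero_smul, Finset.sum_const_zero, add_zero, neg_neg] at e
  ext k
  have ek := congrFun e k
  simp only [Pi.add_apply, Pi.smul_apply, smul_eq_mul] at ek
  cases b <;> simp [boolSign, d] <;> linarith

/-- A normal vector of the mirror through the vertices selected by `ε`. -/
def octaNormal (c : Fin 4 → ℝ) (d : Fin 3 → Fin 4 → ℝ) (ε : Fin 3 → Bool) : Fin 4 → ℝ :=
  c + ∑ i, (boolSign (ε i) / 2) • d i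

/-- The unit normal vector of the mirror through the vertices selected by `ε`. -/
def orthoNormal (c : Fin 5 → ℝ) (d : Fin 4 → Fin 5 → ℝ) (ε : Fin 4 → Bool) : Fin 5 → ℝ :=
  c + ∑ i, (boolSign (ε i) / 2) • d i

lemma Q2_add_right (a b c : Fin 4 → ℝ) : Q2 a (b + c) = Q2 a b + Q2 a c := by
  simp [Q2]; ring

lemma Q2_smul_right (r : ℝ) (a b : Fin 4 → ℝ) : Q2 a (r • b) = r * Q2 a b := by
  simp [Q2]; ring

lemma Q2_comm (a b : Fin 4 → ℝ) : Q2 a b = Q2 b a := by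
  simp only [Q2]; ring

lemma Q3_add_right (a b c : Fin 5 → ℝ) : Q3 a (b + c) = Q3 a b + Q3 a c := by
  simp [Q3]; ring

lemma Q3_smul_right (r : ℝ) (a b : Fin 5 → ℝ) : Q3 a (r • b) = r * Q3 a b := by
  simp [Q3]; ring

lemma Q3_comm (a b : Fin 5 → ℝ) : Q3 a b = Q3 b a := by
  simp only [Q3]; ring

lemma Q3_add_left (a b c : Fin 5 → ℝ) : Q3 (a + b) c = Q3 a c + Q3 b c := by
  simp [Q3]; ring

lemma Q3_smul_left (r : ℝ) (a b : Fin 5 → ℝ) : Q3 (r • a) b = r * Q3 a b := by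
  simp [Q3]; ring

lemma Q2_add_left (a b c : Fin 4 → ℝ) : Q2 (a + b) c = Q2 a c + Q2 b c := by
  simp [Q2]; ring

lemma Q2_smul_left (r : ℝ) (a b : Fin 4 → ℝ) : Q2 (r • a) b = r * Q2 a b := by
  simp [Q2]; ring

lemma IsOctaFrame.normal_self {c : Fin 4 → ℝ} {d : Fin 3 → Fin 4 → ℝ} (h : IsOctaFrame c d)
    (ε : Fin 3 → Bool) : Q2 (octaNormal c d ε) (octaNormal c d ε) = 1 / 2 := by
  simp only [octaNormal, Fin.sum_univ_three, Q2_add_left, Q2_add_right, Q2_smul_left,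
    Q2_smul_right, h.center, h.center_diag, fun i => (Q2_comm (d i) c).trans (h.center_diag i),
    h.diag]
  simp
  linear_combination boolSign_mul_self (ε 0) / 2 + boolSign_mul_self (ε 1) / 2 +
    boolSign_mul_self (ε 2) / 2

lemma IsOrthoFrame.normal_self {c : Fin 5 → ℝ} {d : Fin 4 → Fin 5 → ℝ} (h : IsOrthoFrame c d)
    (ε : Fin 4 → Bool) : Q3 (orthoNormal c d ε) (orthoNormal c d ε) = 1 := by
  simp only [orthoNormal, Fin.sum_univ_four, Q3_add_left, Q3_add_right, Q3_smul_left,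
    Q3_smul_right, h.center, h.center_diag, fun i => (Q3_comm (d i) c).trans (h.center_diag i),
    h.diag]
  simp
  linear_combination boolSign_mul_self (ε 0) / 2 + boolSign_mul_self (ε 1) / 2 +
    boolSign_mul_self (ε 2) / 2 + boolSign_mul_self (ε 3) / 2

lemma IsOrthoFrame.vertex_normal {c : Fin 5 → ℝ} {d : Fin 4 → Fin 5 → ℝ} (h : IsOrthoFrame c d)
    (ε : Fin 4 → Bool) (i : Fin 4) (b : Bool) :
    Q3 (c + boolSign b • d i) (orthoNormal c d ε) = boolSign b * boolSign (ε i) - 1 := by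
  simp only [orthoNormal, Fin.sum_univ_four, Q3_add_left, Q3_add_right, Q3_smul_left,
    Q3_smul_right, h.center, h.center_diag, fun i => (Q3_comm (d i) c).trans (h.center_diag i),
    h.diag]
  fin_cases i <;> simp <;> ring

lemma IsOctaFrame.octaGens_apply {c : Fin 4 → ℝ} {d : Fin 3 → Fin 4 → ℝ} (h : IsOctaFrame c d)
    {y : Fin 3 × Bool → Fin 4 → ℝ} (hy : ∀ i b, y (i, b) = c + boolSign b • d i)
    {g : (Fin 4 → ℝ) ≃ₗ[ℝ] (Fin 4 → ℝ)} (hg : g ∈ octaGens y) :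
    ∃ ε, ∀ z, g z = z - (4 * Q2 z (octaNormal c d ε)) • octaNormal c d ε := by
  obtain ⟨w, hw, ⟨ε, hε⟩, hgw⟩ := hg
  refine ⟨ε, fun z => ?_⟩
  have hd : ∀ i, Q2 w (d i) = boolSign (ε i) * -Q2 w c := fun i => by
    have := hε i
    rw [hy, Q2_add_right, Q2_smul_right] at this
    linear_combination boolSign (ε i) * this - Q2 w (d i) * boolSign_mul_self (ε i)
  have hwn : w = -Q2 w c • octaNormal c d ε := by
    conv_lhs => rw [h.expand w]
    simp only [hd, octaNormal, smul_add, Finset.smul_sum, smul_smul]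
    congr 1
    refine Finset.sum_congr rfl fun i _ => ?_
    congr 1
    ring
  generalize Q2 w c = a at hwn hd
  subst hwn
  rw [Q2_smul_left, Q2_smul_right, h.normal_self] at hw
  rw [hgw, Q2_smul_right, smul_smul]
  congr 2
  linear_combination 4 * Q2 z (octaNormal c d ε) * hw

lemma IsOrthoFrame.orthoGens_apply {c : Fin 5 → ℝ} {d : Fin 4 → Fin 5 → ℝ} (h : IsOrthoFrame c d)
    {x : Fin 4 × Bool → Fin 5 → ℝ} (hx : ∀ i b, x (i, b) = c + boolSign b • d i)
    {g : (Fin 5 → ℝ) ≃ₗ[ℝ] (Fin 5 → ℝ)} (hg : g ∈ orthoGens x) :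
    ∃ ε, ∀ z, g z = z - (2 * Q3 z (orthoNormal c d ε)) • orthoNormal c d ε := by
  obtain ⟨w, hw, ⟨ε, hε⟩, hgw⟩ := hg
  refine ⟨ε, fun z => ?_⟩
  have hd : ∀ i, Q3 w (d i) = boolSign (ε i) * -Q3 w c := fun i => by
    have := hε i
    rw [hx, Q3_add_right, Q3_smul_right] at this
    linear_combination boolSign (ε i) * this - Q3 w (d i) * boolSign_mul_self (ε i)
  have hwn : w = -Q3 w c • orthoNormal c d ε := by
    conv_lhs => rw [h.expand w]
    simp only [hd, orthoNormal, smul_add, Finset.smul_sum, smul_smul]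
    congr 1
    refine Finset.sum_congr rfl fun i _ => ?_
    congr 1
    ring
  generalize Q3 w c = a at hwn hd
  subst hwn
  rw [Q3_smul_left, Q3_smul_right, h.normal_self] at hw
  rw [hgw, Q3_smul_right, smul_smul]
  congr 2
  linear_combination 2 * Q3 z (orthoNormal c d ε) * hw

/-- The reflection in the hyperplane orthogonal to a vector `w` with `Q3 w w = 1`. -/
def orthoReflection (w : Fin 5 → ℝ) (hw : Q3 w w = 1) : (Fin 5 → ℝ) ≃ₗ[ℝ] (Fin 5 → ℝ) :=
  LinearEquiv.ofInvolutive
    { toFun := fun z => z - (2 * Q3 z w) • w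
      map_add' := fun a b => by rw [Q3_add_left]; module
      map_smul' := fun r a => by rw [Q3_smul_left]; simp only [RingHom.id_apply]; module }
    fun z => by
      have : Q3 (z - (2 * Q3 z w) • w) w = -Q3 z w := by
        rw [sub_eq_add_neg, ← neg_smul, Q3_add_left, Q3_smul_left, hw]; ring
      simp only [LinearMap.coe_mk, AddHom.coe_mk, this]
      module

lemma IsOrthoFrame.reflection_mem_orthoGens {c : Fin 5 → ℝ} {d : Fin 4 → Fin 5 → ℝ}
    (h : IsOrthoFrame c d) {x : Fin 4 × Bool → Fin 5 → ℝ}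
    (hx : ∀ i b, x (i, b) = c + boolSign b • d i) (ε : Fin 4 → Bool) :
    orthoReflection (orthoNormal c d ε) (h.normal_self ε) ∈ orthoGens x := by
  refine ⟨_, h.normal_self ε, ⟨ε, fun i => ?_⟩, fun _ => rfl⟩
  rw [Q3_comm, hx, h.vertex_normal, boolSign_mul_self, sub_self]

/-- The additive group spanned by an orthoplicial packing is stable under its Apollonian group. -/
lemma IsOrthoFrame.apply_mem_closure {c : Fin 5 → ℝ} {d : Fin 4 → Fin 5 → ℝ}
    (h : IsOrthoFrame c d) {x : Fin 4 × Bool → Fin 5 → ℝ}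
    (hx : ∀ i b, x (i, b) = c + boolSign b • d i)
    {g : (Fin 5 → ℝ) ≃ₗ[ℝ] (Fin 5 → ℝ)} (hg : g ∈ Subgroup.closure (orthoGens x)) :
    ∀ z ∈ AddSubgroup.closure (Set.range x), g z ∈ AddSubgroup.closure (Set.range x) := by
  set L := AddSubgroup.closure (Set.range x)
  have hxL : ∀ k, x k ∈ L := fun k => AddSubgroup.subset_closure ⟨k, rfl⟩
  have hgen : ∀ g ∈ orthoGens x, ∀ z ∈ L, g z ∈ L := by
    intro g hg z hz
    obtain ⟨ε, hε⟩ := h.orthoGens_apply hx hg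
    have hN : (4 : ℝ) • orthoNormal c d ε ∈ L := by
      have : (4 : ℝ) • orthoNormal c d ε =
          (2 : ℤ) • ((∑ i, x (i, ε i)) - (x (0, true) + x (0, false))) := by
        simp only [hx, orthoNormal, Fin.sum_univ_four, ← Int.cast_smul_eq_zsmul ℝ]
        simp only [boolSign]
        push_cast
        module
      rw [this]
      exact L.zsmul_mem (L.sub_mem (L.sum_mem fun i _ => hxL _)
        (L.add_mem (hxL _) (hxL _))) _
    induction hz using AddSubgroup.closure_induction with
    | mem z hz =>
      obtain ⟨⟨i, b⟩, rfl⟩ := hz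
      rw [hε, hx, h.vertex_normal, ← hx]
      refine L.sub_mem (hxL _) ?_
      cases b <;> cases ε i <;> norm_num [boolSign]
      all_goals exact hN
    | zero => simp
    | add a b _ _ ha hb => rw [map_add]; exact L.add_mem ha hb
    | neg a _ ha => rw [map_neg]; exact L.neg_mem ha
  have hinv : ∀ g ∈ orthoGens x, g⁻¹ = g := by
    rintro g ⟨w, hw, -, hgw⟩
    refine inv_eq_of_mul_eq_one_left (LinearEquiv.ext fun z => ?_)
    have : g = orthoReflection w hw := LinearEquiv.ext hgw
    rw [this]
    exact (orthoReflection w hw).symm_apply_apply z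
  induction hg using Subgroup.closure_induction'' with
  | mem g hg => exact hgen g hg
  | inv_mem g hg => rw [hinv g hg]; exact hgen g hg
  | one => exact fun _ hz => hz
  | mul g₁ g₂ _ _ h₁ h₂ => exact fun z hz => h₁ _ (h₂ z hz)

/-- The section of `ℝ⁵` by the hyperplane on which the third coordinate vanishes. -/
def octaEmbed (a : Fin 4 → ℝ) : Fin 5 → ℝ := ![a 0, a 1, 0, a 2, a 3]

/-- The half-diagonals of the orthoplicial packing having a given octahedral packing as section. -/
def orthoDiag (d : Fin 3 → Fin 4 → ℝ) : Fin 4 → Fin 5 → ℝ :=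
  ![octaEmbed (d 0), octaEmbed (d 1), octaEmbed (d 2), ![0, 0, √2, 0, 0]]

lemma Q3_octaEmbed (a b : Fin 4 → ℝ) : Q3 (octaEmbed a) (octaEmbed b) = Q2 a b := by
  simp [Q3, Q2, octaEmbed]

lemma IsOctaFrame.isOrthoFrame {c : Fin 4 → ℝ} {d : Fin 3 → Fin 4 → ℝ} (h : IsOctaFrame c d) :
    IsOrthoFrame (octaEmbed c) (orthoDiag d) := by
  have hr : √2 * √2 = (2 : ℝ) := Real.mul_self_sqrt (by norm_num)
  have h0 : ∀ a, Q3 (octaEmbed a) ![0, 0, √2, 0, 0] = 0 := fun a => by simp [Q3, octaEmbed]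
  refine ⟨by rw [Q3_octaEmbed, h.center], fun i => ?_, fun i j => ?_, fun z => ?_⟩
  · fin_cases i <;> simp [orthoDiag, Q3_octaEmbed, h.center_diag, h0]
  · fin_cases i <;> fin_cases j <;>
      simp [orthoDiag, Q3_octaEmbed, h.diag, h0, Q3_comm ![0, 0, √2, 0, 0] (octaEmbed _)]
    simp [Q3, hr]
  · have e := h.expand ![z 0, z 1, z 3, z 4]
    have hQ : ∀ a, Q3 z (octaEmbed a) = Q2 ![z 0, z 1, z 3, z 4] a := fun a => by
      simp [Q3, Q2, octaEmbed]
    simp only [Fin.sum_univ_four, orthoDiag, Matrix.cons_val, hQ]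
    rw [Fin.sum_univ_three] at e
    ext k
    fin_cases k
    · simpa [octaEmbed] using congrFun e 0
    · simpa [octaEmbed] using congrFun e 1
    · simp [octaEmbed, Q3]
      linear_combination -z 2 / 2 * hr
    · simpa [octaEmbed] using congrFun e 2
    · simpa [octaEmbed] using congrFun e 3

lemma IsOrthoFrame.isOrthoPacking {c : Fin 5 → ℝ} {d : Fin 4 → Fin 5 → ℝ} (h : IsOrthoFrame c d) :
    IsOrthoPacking fun k => c + boolSign k.2 • d k.1 := by
  have key : ∀ i j a b, Q3 (c + boolSign a • d i) (c + boolSign b • d j) =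
      -1 + boolSign a * boolSign b * if i = j then 2 else 0 := by
    intro i j a b
    simp only [Q3_add_left, Q3_add_right, Q3_smul_left, Q3_smul_right, h.center, h.center_diag,
      fun i => (Q3_comm (d i) c).trans (h.center_diag i), h.diag]
    ring
  simp only [IsOrthoPacking, key, Prod.forall]
  refine ⟨fun i a => ?_, fun i a j b h₁ h₂ => ?_, fun i a => ?_⟩
  · rw [boolSign_mul_self]; norm_num
  · have hij : i ≠ j := by
      rintro rfl
      cases a <;> cases b <;> simp at h₁ h₂
    simp [hij]
  · cases a <;> norm_num [boolSign]

/-- Every reflection of the octahedral group is the restriction of a product of two reflections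
of the orthoplicial group. -/
lemma IsOctaFrame.exists_orthoGroup_extension {c : Fin 4 → ℝ} {d : Fin 3 → Fin 4 → ℝ}
    (h : IsOctaFrame c d) {y : Fin 3 × Bool → Fin 4 → ℝ}
    (hy : ∀ i b, y (i, b) = c + boolSign b • d i) {x : Fin 4 × Bool → Fin 5 → ℝ}
    (hx : ∀ i b, x (i, b) = octaEmbed c + boolSign b • orthoDiag d i)
    {g : (Fin 4 → ℝ) ≃ₗ[ℝ] (Fin 4 → ℝ)} (hg : g ∈ Subgroup.closure (octaGens y)) :
    ∃ k ∈ Subgroup.closure (orthoGens x), ∀ z, k (octaEmbed z) = octaEmbed (g z) := by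
  induction hg using Subgroup.closure_induction with
  | mem g hg =>
    obtain ⟨ε, hε⟩ := h.octaGens_apply hy hg
    have hF := h.isOrthoFrame
    let δ : Bool → Fin 4 → Bool := fun b => ![ε 0, ε 1, ε 2, b]
    refine ⟨_, Subgroup.mul_mem _
      (Subgroup.subset_closure (hF.reflection_mem_orthoGens hx (δ true)))
      (Subgroup.subset_closure (hF.reflection_mem_orthoGens hx (δ false))), fun z => ?_⟩
    set u := octaNormal c d ε with hu
    have hr : √2 * √2 = (2 : ℝ) := Real.mul_self_sqrt (by norm_num)
    have hn : ∀ b, orthoNormal (octaEmbed c) (orthoDiag d) (δ b) =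
        octaEmbed u + (boolSign b / 2) • ![0, 0, √2, 0, 0] := by
      intro b
      ext k
      simp only [orthoNormal, hu, octaNormal, Fin.sum_univ_four, Fin.sum_univ_three, δ,
        orthoDiag]
      fin_cases k <;> simp [octaEmbed]
    have hpm : Q3 (orthoNormal (octaEmbed c) (orthoDiag d) (δ false))
        (orthoNormal (octaEmbed c) (orthoDiag d) (δ true)) = 0 := by
      have := h.normal_self ε
      rw [← hu] at this
      rw [hn, hn]
      simp [Q3, Q2, octaEmbed, boolSign] at this ⊢
      linear_combination this - hr / 4
    have hz : ∀ b, Q3 (octaEmbed z) (orthoNormal (octaEmbed c) (orthoDiag d) (δ b)) = Q2 z u := by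
      intro b
      rw [hn]
      simp [Q3, Q2, octaEmbed]
    change octaEmbed z - (2 * Q3 (octaEmbed z) _) • _ - (2 * Q3 (octaEmbed z -
      (2 * Q3 (octaEmbed z) _) • _) _) • _ = _
    rw [sub_eq_add_neg (octaEmbed z), ← neg_smul, Q3_add_left, Q3_smul_left, hpm, hz, hz, hε, hn,
      hn]
    ext k
    fin_cases k <;> simp [octaEmbed, boolSign] <;> ring
  | one => exact ⟨1, one_mem _, fun _ => rfl⟩
  | mul g₁ g₂ _ _ h₁ h₂ =>
    obtain ⟨k₁, hk₁, e₁⟩ := h₁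
    obtain ⟨k₂, hk₂, e₂⟩ := h₂
    refine ⟨k₁ * k₂, mul_mem hk₁ hk₂, fun z => ?_⟩
    rw [LinearEquiv.mul_apply, LinearEquiv.mul_apply, e₂, e₁]
  | inv g _ hg =>
    obtain ⟨k, hk, e⟩ := hg
    refine ⟨k⁻¹, inv_mem hk, fun z => ?_⟩
    have := e (g.symm z)
    rw [LinearEquiv.apply_symm_apply] at this
    rw [← this]
    exact k.symm_apply_apply _

/-- The centre of an integral octahedral packing has integral curvature. -/
lemma IsOctaFrame.exists_int_curv2_center {c : Fin 4 → ℝ} {d : Fin 3 → Fin 4 → ℝ}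
    (h : IsOctaFrame c d) (hint : ∀ i b, ∃ n : ℤ, curv2 (c + boolSign b • d i) = n) :
    ∃ n : ℤ, curv2 c = n := by
  choose n hn using hint
  have hsum : ∀ i, (n i true : ℝ) + n i false = 2 * curv2 c := fun i => by
    rw [← hn, ← hn]; simp [curv2, boolSign]; ring
  have hdiff : ∀ i, 2 * curv2 (d i) = n i true - n i false := fun i => by
    rw [← hn, ← hn]; simp [curv2, boolSign]; ring
  set m : ℤ := n 0 true + n 0 false with hm
  have hmc : (m : ℝ) = 2 * curv2 c := by rw [hm]; push_cast; exact hsum 0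
  have hd : ∀ i, 2 * curv2 (d i) = 2 * n i true - m := fun i => by
    linarith [hsum i, hdiff i]
  have hsq : m ^ 2 = 2 * (2 * ∑ i, n i true * (m - n i true)) := by
    have := h.curv2_sq
    rw [Fin.sum_univ_three] at this ⊢
    have hR : (m : ℝ) ^ 2 = 2 * (2 * (n 0 true * (m - n 0 true) + n 1 true * (m - n 1 true) +
        n 2 true * (m - n 2 true))) := by
      have e : 2 * (m : ℝ) ^ 2 = (2 * n 0 true - m) ^ 2 + (2 * n 1 true - m) ^ 2 +
          (2 * n 2 true - m) ^ 2 := by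
        rw [← hd, ← hd, ← hd, hmc]
        linear_combination 4 * this
      linear_combination -e
    exact_mod_cast hR
  have heven : Even m := by
    have : Even (m ^ 2) := hsq ▸ even_two_mul _
    exact (Int.even_pow.mp this).1
  obtain ⟨q, hq⟩ := heven
  refine ⟨q, ?_⟩
  rw [hq] at hmc
  push_cast at hmc
  linarith

/-- Theorem 1 (octahedral case): every octahedral Apollonian disk packing has its set of
curvatures contained in the set of curvatures of some orthoplicial Apollonian sphere packing,
and one is integral iff the other is. -/
theorem octa_section_of_orthoplicial (y : Fin 3 × Bool → (Fin 4 → ℝ)) (hy : IsOctaPacking y) :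
    ∃ x : Fin 4 × Bool → (Fin 5 → ℝ), IsOrthoPacking x ∧
      curv2 '' octaOmega y ⊆ curv3 '' orthoOmega x ∧
      ((∀ b ∈ octaOmega y, ∃ n : ℤ, curv2 b = n) ↔
        (∀ b ∈ orthoOmega x, ∃ n : ℤ, curv3 b = n)) := by
  obtain ⟨c, d, hf, hyf⟩ := hy.exists_frame
  have hF := hf.isOrthoFrame
  let x : Fin 4 × Bool → Fin 5 → ℝ := fun k => octaEmbed c + boolSign k.2 • orthoDiag d k.1
  have hx : ∀ i b, x (i, b) = octaEmbed c + boolSign b • orthoDiag d i := fun _ _ => rfl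
  have hxy : ∀ i : Fin 3, ∀ b, x (i.castSucc, b) = octaEmbed (y (i, b)) := by
    intro i b
    rw [hyf, hx]
    ext k
    fin_cases i <;> fin_cases k <;> simp [orthoDiag, octaEmbed]
  have hcurv : ∀ z, curv3 (octaEmbed z) = curv2 z := fun z => rfl
  have hsub : ∀ b ∈ octaOmega y, octaEmbed b ∈ orthoOmega x := by
    rintro _ ⟨g, hg, ⟨i, b⟩, rfl⟩
    obtain ⟨k, hk, e⟩ := hf.exists_orthoGroup_extension hyf hx hg
    exact ⟨k, hk, (i.castSucc, b), by rw [hxy, e]⟩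
  refine ⟨x, hF.isOrthoPacking, ?_, fun hint => ?_, fun hint b hb => hint _ (hsub b hb)⟩
  · rintro _ ⟨b, hb, rfl⟩
    exact ⟨_, hsub b hb, hcurv b⟩
  · have hyint : ∀ k, ∃ n : ℤ, curv2 (y k) = n := fun k => hint _ ⟨1, one_mem _, k, rfl⟩
    obtain ⟨m, hm⟩ := hf.exists_int_curv2_center fun i b => hyf i b ▸ hyint (i, b)
    have hxint : ∀ i b, ∃ n : ℤ, curv3 (x (i, b)) = n := by
      intro i b
      induction i using Fin.lastCases with
      | last => exact ⟨m, by rw [← hm]; simp [hx, curv3, curv2, octaEmbed, orthoDiag]⟩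
      | cast i => rw [hxy, hcurv]; exact hyint _
    have hL : ∀ z ∈ AddSubgroup.closure (Set.range x), ∃ n : ℤ, curv3 z = n := by
      intro z hz
      induction hz using AddSubgroup.closure_induction with
      | mem z hz => obtain ⟨⟨i, b⟩, rfl⟩ := hz; exact hxint i b
      | zero => exact ⟨0, by simp [curv3]⟩
      | add a b _ _ ha hb =>
        obtain ⟨p, hp⟩ := ha
        obtain ⟨q, hq⟩ := hb
        refine ⟨p + q, ?_⟩
        push_cast
        rw [← hp, ← hq]
        simp only [curv3, Pi.add_apply]
        ring
      | neg a _ ha =>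
        obtain ⟨p, hp⟩ := ha
        refine ⟨-p, ?_⟩
        push_cast
        rw [← hp]
        simp only [curv3, Pi.neg_apply]
        ring
    rintro _ ⟨g, hg, k, rfl⟩
    exact hL _ (hF.apply_mem_closure hx hg _ (AddSubgroup.subset_closure ⟨k, rfl⟩))
end
end

section
/- Antipodal relation for cross-polytopes. Let d ≥ 2 and let x be a (d+1)-cross-polytope ball packing in ℝ^{d+2}. Then for all indices i, j ∈ {1,…,d+1}: κ(xᵢ) + κ(x₋ᵢ) = κ(xⱼ) + κ(x₋ⱼ); that is, the mean of the curvatures of any pair of antipodal balls (balls at maximal distance in the 1-skeleton of the cross-polytope) is independent of the pair. -/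
noncomputable section

open Finset

/-- Inversive product on ℝ^{d+2}. -/
def Qd (d : ℕ) (a b : Fin (d + 2) → ℝ) : ℝ :=
  (∑ i : Fin (d + 1), a i.castSucc * b i.castSucc) -
    a (Fin.last (d + 1)) * b (Fin.last (d + 1))

/-- Curvature of a d-ball in inversive coordinates. -/
def curvd (d : ℕ) (a : Fin (d + 2) → ℝ) : ℝ :=
  a (Fin.last (d + 1)) - a ((Fin.last d).castSucc)

/-- A (d+1)-cross-polytope ball packing, indexed by `{±1,…,±(d+1)}`
(here `Fin (d+1) × Bool`, with negation flipping the boolean). -/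
def IsCrossPacking (d : ℕ) (x : Fin (d + 1) × Bool → (Fin (d + 2) → ℝ)) : Prop :=
  (∀ k, Qd d (x k) (x k) = 1) ∧
  (∀ k l, l ≠ k → l ≠ (k.1, !k.2) → Qd d (x k) (x l) = -1) ∧
  (∀ k, Qd d (x k) (x (k.1, !k.2)) = -3)

/-- The inversive product as a bilinear form. -/
def inversiveForm (d : ℕ) : LinearMap.BilinForm ℝ (Fin (d + 2) → ℝ) :=
  LinearMap.mk₂ ℝ (Qd d)
    (fun a b c => by simp only [Qd, Pi.add_apply, add_mul, sum_add_distrib]; ring)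
    (fun r a b => by simp only [Qd, Pi.smul_apply, smul_eq_mul, mul_sub, mul_sum, mul_assoc])
    (fun a b c => by simp only [Qd, Pi.add_apply, mul_add, sum_add_distrib]; ring)
    (fun r a b => by
      simp only [Qd, Pi.smul_apply, smul_eq_mul, mul_sub, mul_sum, mul_left_comm _ r])

@[simp]
lemma inversiveForm_apply (d : ℕ) (a b : Fin (d + 2) → ℝ) : inversiveForm d a b = Qd d a b :=
  rfl

/-- The curvature is the inversive product with a fixed isotropic vector. -/
lemma curvd_eq_inversiveForm (d : ℕ) (a : Fin (d + 2) → ℝ) :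
    curvd d a = inversiveForm d a
      (-Pi.single (Fin.last d).castSucc 1 - Pi.single (Fin.last (d + 1)) 1) := by
  simp [curvd, Qd, Pi.single_apply, Fin.castSucc_ne_last, (Fin.castSucc_ne_last _).symm]
  ring

namespace IsCrossPacking

variable {d : ℕ} {x : Fin (d + 1) × Bool → Fin (d + 2) → ℝ}

lemma form_eq (hx : IsCrossPacking d x) (k l : Fin (d + 1)) (a b : Bool) :
    inversiveForm d (x (k, a)) (x (l, b)) = if k = l then (if a = b then 1 else -3) else -1 := by
  obtain ⟨hself, hadj, hanti⟩ := hx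
  rw [inversiveForm_apply]
  split_ifs with hkl hab
  · subst hkl hab
    exact hself _
  · subst hkl
    obtain rfl : b = !a := by cases a <;> cases b <;> simp_all
    exact hanti (k, a)
  · exact hadj _ _ (by simp [Ne.symm hkl]) (by simp [Ne.symm hkl])

/-- The differences of antipodal vectors, together with the sum of the antipodal pair `i`. -/
def frame (x : Fin (d + 1) × Bool → Fin (d + 2) → ℝ) (i : Fin (d + 1)) :
    Option (Fin (d + 1)) → Fin (d + 2) → ℝ
  | none => x (i, true) + x (i, false)
  | some k => x (k, true) - x (k, false)

lemma linearIndependent_frame (hx : IsCrossPacking d x) (i : Fin (d + 1)) :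
    LinearIndependent ℝ (frame x i) := by
  refine LinearMap.linearIndependent_of_isOrthoᵢ (B := inversiveForm d) ?_ ?_
  · rw [LinearMap.isOrthoᵢ_def]
    rintro (_ | k) (_ | l) hkl
    · exact absurd rfl hkl
    · simp only [frame, map_add, map_sub, LinearMap.add_apply, hx.form_eq]
      split_ifs <;> simp_all <;> norm_num
    · simp only [frame, map_add, map_sub, LinearMap.sub_apply, hx.form_eq]
      split_ifs <;> simp_all <;> norm_num
    · have hne : k ≠ l := fun h => hkl (congrArg some h)
      simp [frame, -inversiveForm_apply, hx.form_eq, hne]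
  · rintro (_ | k) h
    · simp only [frame, map_add, LinearMap.add_apply, hx.form_eq] at h
      norm_num at h
    · simp only [frame, map_sub, LinearMap.sub_apply, hx.form_eq] at h
      norm_num at h

lemma span_frame (hx : IsCrossPacking d x) (i : Fin (d + 1)) :
    Submodule.span ℝ (Set.range (frame x i)) = ⊤ :=
  (hx.linearIndependent_frame i).span_eq_top_of_card_eq_finrank' (by simp)

lemma inversiveForm_sum_sub_sum (hx : IsCrossPacking d x) (i j : Fin (d + 1)) :
    inversiveForm d (x (i, true) + x (i, false) - (x (j, true) + x (j, false))) = 0 := by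
  refine LinearMap.ext_on_range (hx.span_frame i) ?_
  rintro (_ | k) <;>
    simp only [frame, map_add, map_sub, LinearMap.add_apply, LinearMap.sub_apply, hx.form_eq,
      LinearMap.zero_apply] <;>
    split_ifs <;> simp_all <;> norm_num

end IsCrossPacking

/-- Antipodal relation for cross-polytopes: the sum of the curvatures of an antipodal pair of
balls does not depend on the pair. -/
theorem cross_polytope_antipodal (d : ℕ) (hd : 2 ≤ d)
    (x : Fin (d + 1) × Bool → (Fin (d + 2) → ℝ)) (hx : IsCrossPacking d x)
    (i j : Fin (d + 1)) :
    curvd d (x (i, true)) + curvd d (x (i, false)) =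
      curvd d (x (j, true)) + curvd d (x (j, false)) := by
  have h := LinearMap.congr_fun (hx.inversiveForm_sum_sub_sum i j)
    (-Pi.single (Fin.last d).castSucc 1 - Pi.single (Fin.last (d + 1)) 1)
  simp only [map_add, map_sub _ (_ + _), LinearMap.add_apply, LinearMap.sub_apply,
    ← curvd_eq_inversiveForm, LinearMap.zero_apply] at h
  linarith
end
end
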